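/- arXiv:1105.5018 — 5 statements merged into one kernel-verified Lean document; each statement's English description precedes it below -/
import Mathlib

section
/- Let X be a compact metric space, F : X → Set X a set-valued map with nonempty compact values that is upper semicontinuous (whenever x_n → x, y_n ∈ F(x_n) and y_n → y, then y ∈ F(x)), and let M ⊆ X be nonempty and compact with F(M) ⊆ M. Then the ω-limit set Ω := ⋂_{n ≥ 0} closure(⋃_{m ≥ n} Fᵐ(M)) is nonempty, compact, and F-invariant, i.e. F(Ω) = Ω. -/
open Metric Set Filter Topology

/-- The extension of a set-valued map to subsets: `F(A) = ⋃_{x ∈ A} F(x)`. -/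
def setImage {X : Type*} (F : X → Set X) (A : Set X) : Set X := ⋃ x ∈ A, F x

theorem mem_setImage {X : Type*} {F : X → Set X} {A : Set X} {y : X} :
    y ∈ setImage F A ↔ ∃ x ∈ A, y ∈ F x := by
  simp [setImage]

theorem setImage_mono {X : Type*} (F : X → Set X) : Monotone (setImage F) :=
  fun _ _ h => biUnion_subset_biUnion_left h

theorem setImage_nonempty {X : Type*} {F : X → Set X} {A : Set X} (hA : A.Nonempty)
    (hne : ∀ x, (F x).Nonempty) : (setImage F A).Nonempty := by
  obtain ⟨x, hx⟩ := hA
  obtain ⟨y, hy⟩ := hne x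
  exact ⟨y, mem_setImage.2 ⟨x, hx, hy⟩⟩

/-- A set-valued map with sequentially closed graph on a compact metric space maps closed sets
to closed sets. -/
theorem isClosed_setImage {X : Type*} [MetricSpace X] [CompactSpace X] {F : X → Set X}
    (husc : ∀ (x y : ℕ → X) (a b : X), Tendsto x atTop (𝓝 a) →
      (∀ n, y n ∈ F (x n)) → Tendsto y atTop (𝓝 b) → b ∈ F a)
    {A : Set X} (hA : IsClosed A) : IsClosed (setImage F A) := by
  refine IsSeqClosed.isClosed fun y b hy hb => ?_
  choose x hxA hxy using fun n => mem_setImage.1 (hy n)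
  obtain ⟨a, ha, φ, hφ, hlim⟩ := hA.isCompact.tendsto_subseq hxA
  exact mem_setImage.2 ⟨a, ha, husc _ (y ∘ φ) a b hlim (fun n => hxy (φ n))
    (hb.comp hφ.tendsto_atTop)⟩

/-- A set-valued map with sequentially closed graph on a compact metric space commutes with
intersections of decreasing sequences of closed sets. -/
theorem setImage_iInter_of_antitone {X : Type*} [MetricSpace X] [CompactSpace X] {F : X → Set X}
    (husc : ∀ (x y : ℕ → X) (a b : X), Tendsto x atTop (𝓝 a) →
      (∀ n, y n ∈ F (x n)) → Tendsto y atTop (𝓝 b) → b ∈ F a)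
    {K : ℕ → Set X} (hK : Antitone K) (hclosed : ∀ n, IsClosed (K n)) :
    setImage F (⋂ n, K n) = ⋂ n, setImage F (K n) := by
  refine (subset_iInter fun n => setImage_mono F (iInter_subset K n)).antisymm fun y hy => ?_
  choose x hxK hxy using fun n => mem_setImage.1 (mem_iInter.1 hy n)
  obtain ⟨a, φ, hφ, hlim⟩ := CompactSpace.tendsto_subseq x
  refine mem_setImage.2 ⟨a, mem_iInter.2 fun n => ?_,
    husc _ _ a y hlim (fun n => hxy (φ n)) tendsto_const_nhds⟩
  refine (hclosed n).mem_of_tendsto hlim ?_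
  filter_upwards [eventually_ge_atTop n] with k hk
  exact hK (hk.trans (hφ.id_le k)) (hxK (φ k))

/-- For an upper semicontinuous set-valued map `F` with nonempty compact
values on a compact metric space, and a nonempty compact `M` with `F(M) ⊆ M`, the
ω-limit set `Ω = ⋂_{n} closure (⋃_{m ≥ n} Fᵐ(M))` is nonempty, compact, and
`F`-invariant. -/
theorem omega_limit_invariant {X : Type*} [MetricSpace X] [CompactSpace X]
    (F : X → Set X)
    (hne : ∀ x, (F x).Nonempty)
    (hcpt : ∀ x, IsCompact (F x))
    (husc : ∀ (x y : ℕ → X) (a b : X), Tendsto x atTop (𝓝 a) →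
      (∀ n, y n ∈ F (x n)) → Tendsto y atTop (𝓝 b) → b ∈ F a)
    (M : Set X) (hMne : M.Nonempty) (hMc : IsCompact M)
    (hsub : setImage F M ⊆ M) :
    ((⋂ n : ℕ, closure (⋃ m ∈ {m : ℕ | n ≤ m}, (setImage F)^[m] M)).Nonempty ∧
      IsCompact (⋂ n : ℕ, closure (⋃ m ∈ {m : ℕ | n ≤ m}, (setImage F)^[m] M)) ∧
      setImage F (⋂ n : ℕ, closure (⋃ m ∈ {m : ℕ | n ≤ m}, (setImage F)^[m] M)) =
        ⋂ n : ℕ, closure (⋃ m ∈ {m : ℕ | n ≤ m}, (setImage F)^[m] M)) := by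
  have hanti : Antitone fun n => (setImage F)^[n] M :=
    (setImage_mono F).antitone_iterate_of_map_le hsub
  have hclosed : ∀ n, IsClosed ((setImage F)^[n] M) := fun n => by
    induction n with
    | zero => exact hMc.isClosed
    | succ n ih =>
      rw [Function.iterate_succ_apply']
      exact isClosed_setImage husc ih
  have hnonempty : ∀ n, ((setImage F)^[n] M).Nonempty := fun n => by
    induction n with
    | zero => exact hMne
    | succ n ih =>
      rw [Function.iterate_succ_apply']
      exact setImage_nonempty ih hne
  have htail : ∀ n, closure (⋃ m ∈ {m : ℕ | n ≤ m}, (setImage F)^[m] M) =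
      (setImage F)^[n] M := fun n => by
    have h : (⋃ m ∈ {m : ℕ | n ≤ m}, (setImage F)^[m] M) = (setImage F)^[n] M :=
      Subset.antisymm (iUnion₂_subset fun _ hm => hanti hm)
        (subset_biUnion_of_mem (u := fun m => (setImage F)^[m] M) (show n ∈ {m : ℕ | n ≤ m} from le_refl n))
    rw [h, (hclosed n).closure_eq]
  simp only [htail]
  refine ⟨?_, (isClosed_iInter hclosed).isCompact, ?_⟩
  · exact IsCompact.nonempty_iInter_of_sequence_nonempty_isCompact_isClosed _
      (fun n => hanti n.le_succ) hnonempty hMc hclosed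
  · rw [setImage_iInter_of_antitone husc hanti hclosed]
    simp only [← Function.iterate_succ_apply']
    exact hanti.iInter_nat_add 1
end

section
/- Let X = [-4, 4] ⊆ ℝ and for λ ∈ (0, 1] define F_λ : X → Set X by F_λ(x) = [x/2 − λ − 1, x/2 − λ] for x < 0, F_λ(0) = [−2, 2], and F_λ(x) = [x/2 + λ, x/2 + λ + 1] for x > 0. Then a nonempty compact set M ⊆ [-4, 4] is a minimal F_λ-invariant set if and only if M = [−2λ − 2, −2λ] or M = [2λ, 2λ + 2]; in particular, F_λ has exactly two minimal invariant sets. -/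
open Set

/-- The set-valued map of Example 2 of the paper, for parameter `λ ∈ (0, 1]`:
`F_λ(x) = [x/2 − λ − 1, x/2 − λ]` for `x < 0`, `F_λ(0) = [−2, 2]`, and
`F_λ(x) = [x/2 + λ, x/2 + λ + 1]` for `x > 0`. -/
noncomputable def Fex (l x : ℝ) : Set ℝ :=
  if x < 0 then Icc (x / 2 - l - 1) (x / 2 - l)
  else if x = 0 then Icc (-2) 2
  else Icc (x / 2 + l) (x / 2 + l + 1)

theorem Fex_of_neg {l x : ℝ} (hx : x < 0) :
    Fex l x = Icc (x / 2 - l - 1) (x / 2 - l) := by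
  simp [Fex, hx]

theorem Fex_of_pos {l x : ℝ} (hx : 0 < x) :
    Fex l x = Icc (x / 2 + l) (x / 2 + l + 1) := by
  simp [Fex, hx.not_gt, hx.ne']

theorem Fex_zero (l : ℝ) : Fex l 0 = Icc (-2) 2 := by
  simp [Fex]

/-- A closed set contains `y` as soon as it contains a nonempty set stable under taking
midpoints with `y`. -/
theorem mem_of_isClosed_of_midpoint_mem {M S : Set ℝ} (hM : IsClosed M) (hSM : S ⊆ M)
    (hS : S.Nonempty) {y : ℝ} (hy : ∀ m ∈ S, (m + y) / 2 ∈ S) : y ∈ M := by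
  obtain ⟨x, hx⟩ := hS
  have hmem : ∀ n : ℕ, y + (x - y) * (1 / 2) ^ n ∈ S := by
    intro n
    induction n with
    | zero => simpa using hx
    | succ n ih =>
      convert hy _ ih using 1
      ring
  have hlim : Filter.Tendsto (fun n : ℕ => y + (x - y) * (1 / 2 : ℝ) ^ n)
      Filter.atTop (nhds y) := by
    simpa using ((tendsto_pow_atTop_nhds_zero_of_lt_one (r := (1 / 2 : ℝ))
      (by norm_num) (by norm_num)).const_mul (x - y)).const_add y
  exact hM.mem_of_tendsto hlim (Filter.Eventually.of_forall fun n => hSM (hmem n))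

theorem Icc_subset_of_invariant_of_pos {l : ℝ} (hl : 0 < l) {M : Set ℝ} (hM : IsClosed M)
    (hinv : (⋃ x ∈ M, Fex l x) = M) {x : ℝ} (hx : x ∈ M) (hx0 : 0 < x) :
    Icc (2 * l) (2 * l + 2) ⊆ M := by
  rintro y ⟨hy₁, hy₂⟩
  refine mem_of_isClosed_of_midpoint_mem (S := M ∩ Ioi 0) hM inter_subset_left
    ⟨x, hx, hx0⟩ ?_
  rintro m ⟨hm, hm0 : 0 < m⟩
  refine ⟨?_, show 0 < (m + y) / 2 by linarith⟩
  rw [← hinv]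
  refine mem_biUnion hm ?_
  rw [Fex_of_pos hm0]
  constructor <;> linarith

theorem Icc_subset_of_invariant_of_neg {l : ℝ} (hl : 0 < l) {M : Set ℝ} (hM : IsClosed M)
    (hinv : (⋃ x ∈ M, Fex l x) = M) {x : ℝ} (hx : x ∈ M) (hx0 : x < 0) :
    Icc (-2 * l - 2) (-2 * l) ⊆ M := by
  rintro y ⟨hy₁, hy₂⟩
  refine mem_of_isClosed_of_midpoint_mem (S := M ∩ Iio 0) hM inter_subset_left
    ⟨x, hx, hx0⟩ ?_
  rintro m ⟨hm, hm0 : m < 0⟩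
  refine ⟨?_, show (m + y) / 2 < 0 by linarith⟩
  rw [← hinv]
  refine mem_biUnion hm ?_
  rw [Fex_of_neg hm0]
  constructor <;> linarith

theorem biUnion_Fex_Icc_pos {l : ℝ} (hl : 0 < l) :
    (⋃ x ∈ Icc (2 * l) (2 * l + 2), Fex l x) = Icc (2 * l) (2 * l + 2) := by
  refine Subset.antisymm (iUnion₂_subset ?_) fun y hy => mem_biUnion hy ?_
  · rintro x ⟨hx₁, hx₂⟩
    rw [Fex_of_pos (by linarith)]
    exact Icc_subset_Icc (by linarith) (by linarith)
  · obtain ⟨hy₁, hy₂⟩ := hy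
    rw [Fex_of_pos (by linarith)]
    constructor <;> linarith

theorem biUnion_Fex_Icc_neg {l : ℝ} (hl : 0 < l) :
    (⋃ x ∈ Icc (-2 * l - 2) (-2 * l), Fex l x) = Icc (-2 * l - 2) (-2 * l) := by
  refine Subset.antisymm (iUnion₂_subset ?_) fun y hy => mem_biUnion hy ?_
  · rintro x ⟨hx₁, hx₂⟩
    rw [Fex_of_neg (by linarith)]
    exact Icc_subset_Icc (by linarith) (by linarith)
  · obtain ⟨hy₁, hy₂⟩ := hy
    rw [Fex_of_neg (by linarith)]
    constructor <;> linarith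

theorem exists_ne_zero_of_invariant {l : ℝ} {M : Set ℝ} (hne : M.Nonempty)
    (hinv : (⋃ x ∈ M, Fex l x) = M) : ∃ x ∈ M, x ≠ 0 := by
  obtain ⟨x, hx⟩ := hne
  rcases eq_or_ne x 0 with rfl | h
  · refine ⟨1, ?_, one_ne_zero⟩
    rw [← hinv]
    refine mem_biUnion hx ?_
    rw [Fex_zero]
    constructor <;> norm_num
  · exact ⟨x, hx, h⟩

/-- For `λ ∈ (0, 1]`, a nonempty compact `M ⊆ [-4, 4]` is a minimal
`F_λ`-invariant set iff `M = [−2λ − 2, −2λ]` or `M = [2λ, 2λ + 2]`; in particular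
`F_λ` has exactly two minimal invariant sets. -/
theorem example_two_minimal_invariant_sets (l : ℝ) (hl : l ∈ Ioc (0 : ℝ) 1)
    (M : Set ℝ) (hMne : M.Nonempty) (hMc : IsCompact M)
    (hMsub : M ⊆ Icc (-4 : ℝ) 4) :
    ((⋃ x ∈ M, Fex l x) = M ∧
        ∀ M' : Set ℝ, M' ⊂ M → M'.Nonempty → IsCompact M' →
          (⋃ x ∈ M', Fex l x) ≠ M') ↔
      (M = Icc (-2 * l - 2) (-2 * l) ∨ M = Icc (2 * l) (2 * l + 2)) := by
  have hl0 : 0 < l := hl.1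
  constructor
  · rintro ⟨hinv, hmin⟩
    obtain ⟨x, hx, hx0⟩ := exists_ne_zero_of_invariant hMne hinv
    rcases lt_or_gt_of_ne hx0 with h | h
    · left
      by_contra hne
      exact hmin _ ((Icc_subset_of_invariant_of_neg hl0 hMc.isClosed hinv hx h).ssubset_of_ne
        (Ne.symm hne)) (nonempty_Icc.2 (by linarith)) isCompact_Icc (biUnion_Fex_Icc_neg hl0)
    · right
      by_contra hne
      exact hmin _ ((Icc_subset_of_invariant_of_pos hl0 hMc.isClosed hinv hx h).ssubset_of_ne
        (Ne.symm hne)) (nonempty_Icc.2 (by linarith)) isCompact_Icc (biUnion_Fex_Icc_pos hl0)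
  · rintro (rfl | rfl)
    · refine ⟨biUnion_Fex_Icc_neg hl0, fun M' hss ⟨x, hx⟩ hc hinv => hss.2 ?_⟩
      have hx' := (hss.1 hx).2
      exact Icc_subset_of_invariant_of_neg hl0 hc.isClosed hinv hx (by linarith)
    · refine ⟨biUnion_Fex_Icc_pos hl0, fun M' hss ⟨x, hx⟩ hc hinv => hss.2 ?_⟩
      have hx' := (hss.1 hx).1
      exact Icc_subset_of_invariant_of_pos hl0 hc.isClosed hinv hx (by linarith)
end

section
/- Let X = [-4, 4] ⊆ ℝ and define F₀ : X → Set X by F₀(x) = [x/2 − 1, x/2] for x < 0, F₀(0) = [−2, 2], and F₀(x) = [x/2, x/2 + 1] for x > 0. Then a nonempty compact set M ⊆ [-4, 4] is a minimal F₀-invariant set if and only if M = [−2, 2]; in particular, [−2, 2] is the unique minimal invariant set of F₀. -/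
open Set

/-- The set-valued map of Example 2 of the paper at parameter `λ = 0`:
`F₀(x) = [x/2 − 1, x/2]` for `x < 0`, `F₀(0) = [−2, 2]`, and
`F₀(x) = [x/2, x/2 + 1]` for `x > 0`. -/
noncomputable def Fzero (x : ℝ) : Set ℝ :=
  if x < 0 then Icc (x / 2 - 1) (x / 2)
  else if x = 0 then Icc (-2) 2
  else Icc (x / 2) (x / 2 + 1)

theorem half_mem_Fzero (x : ℝ) : x / 2 ∈ Fzero x := by
  unfold Fzero
  split_ifs with h h'
  · constructor <;> linarith
  · subst h'
    constructor <;> norm_num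
  · constructor <;> linarith

theorem le_of_mem_Fzero {x y m : ℝ} (hy : y ∈ Fzero x) (hx : x ≤ m) (hm : 2 ≤ m) :
    y ≤ m / 2 + 1 := by
  unfold Fzero at hy
  split_ifs at hy <;> linarith [hy.2]

theorem ge_of_mem_Fzero {x y m : ℝ} (hy : y ∈ Fzero x) (hx : m ≤ x) (hm : m ≤ -2) :
    m / 2 - 1 ≤ y := by
  unfold Fzero at hy
  split_ifs at hy <;> linarith [hy.1]

theorem Fzero_zero : Fzero 0 = Icc (-2) 2 := by
  simp [Fzero]

theorem iUnion_Fzero_Icc : (⋃ x ∈ Icc (-2 : ℝ) 2, Fzero x) = Icc (-2) 2 := by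
  apply Subset.antisymm
  · refine iUnion₂_subset fun x hx y hy => ⟨?_, ?_⟩
    · linarith [ge_of_mem_Fzero hy hx.1 le_rfl]
    · linarith [le_of_mem_Fzero hy hx.2 le_rfl]
  · rw [← Fzero_zero]
    exact subset_biUnion_of_mem (u := Fzero) (by norm_num [Fzero_zero])

theorem zero_mem_of_iUnion_Fzero_subset {M : Set ℝ} (hne : M.Nonempty) (hM : IsClosed M)
    (h : (⋃ x ∈ M, Fzero x) ⊆ M) : (0 : ℝ) ∈ M := by
  obtain ⟨x, hx⟩ := hne
  have hmem : ∀ n : ℕ, x * (1 / 2) ^ n ∈ M := by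
    intro n
    induction n with
    | zero => simpa using hx
    | succ n ih =>
      have := h (mem_biUnion ih (half_mem_Fzero _))
      convert this using 1
      ring
  have hlim : Filter.Tendsto (fun n : ℕ => x * (1 / 2 : ℝ) ^ n) Filter.atTop (nhds 0) := by
    simpa using (tendsto_pow_atTop_nhds_zero_of_lt_one (r := (1 / 2 : ℝ))
      (by norm_num) (by norm_num)).const_mul x
  exact hM.mem_of_tendsto hlim (Filter.Eventually.of_forall hmem)

/-- Every nonempty compact `F₀`-invariant set is `[-2, 2]`. -/
theorem eq_Icc_of_iUnion_Fzero_eq {M : Set ℝ} (hne : M.Nonempty) (hM : IsCompact M)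
    (h : (⋃ x ∈ M, Fzero x) = M) : M = Icc (-2 : ℝ) 2 := by
  have h0 := zero_mem_of_iUnion_Fzero_subset hne hM.isClosed h.subset
  have hsub : Icc (-2 : ℝ) 2 ⊆ M := by
    rw [← Fzero_zero]
    exact (subset_biUnion_of_mem (u := Fzero) h0).trans h.subset
  refine Subset.antisymm ?_ hsub
  obtain ⟨b, hb, hbmax⟩ := hM.exists_isGreatest hne
  obtain ⟨a, ha, hamin⟩ := hM.exists_isLeast hne
  have hb2 : 2 ≤ b := hbmax (hsub (by norm_num))
  have ha2 : a ≤ -2 := hamin (hsub (by norm_num))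
  obtain ⟨x, hx, hbx⟩ := mem_iUnion₂.1 (h.superset hb)
  obtain ⟨y, hy, hay⟩ := mem_iUnion₂.1 (h.superset ha)
  have hble := le_of_mem_Fzero hbx (hbmax hx) hb2
  have hage := ge_of_mem_Fzero hay (hamin hy) ha2
  intro z hz
  have hzb := hbmax hz
  have haz := hamin hz
  constructor <;> linarith

/-- A nonempty compact `M ⊆ [-4, 4]` is a minimal `F₀`-invariant set iff
`M = [−2, 2]`; in particular `[−2, 2]` is the unique minimal invariant set of `F₀`. -/
theorem example_unique_minimal_invariant_set
    (M : Set ℝ) (hMne : M.Nonempty) (hMc : IsCompact M)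
    (hMsub : M ⊆ Icc (-4 : ℝ) 4) :
    ((⋃ x ∈ M, Fzero x) = M ∧
        ∀ M' : Set ℝ, M' ⊂ M → M'.Nonempty → IsCompact M' →
          (⋃ x ∈ M', Fzero x) ≠ M') ↔
      M = Icc (-2 : ℝ) 2 := by
  constructor
  · rintro ⟨h, -⟩
    exact eq_Icc_of_iUnion_Fzero_eq hMne hMc h
  · rintro rfl
    exact ⟨iUnion_Fzero_Icc, fun M' hss hne hc h =>
      hss.ne (eq_Icc_of_iUnion_Fzero_eq hne hc h)⟩
end

section
/- Let ε > 0 and α ∈ ℝ. Then there exists x > 0 with α·x/(1 + x) − ε = x if and only if α ≥ 1 + ε + 2√ε. (This characterises the bifurcation threshold α* = 1 + ε + 2√ε at which the lower extremal map f_{α,0} − ε acquires a positive fixed point.) -/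
/-- For `ε > 0` and `α ∈ ℝ`, the lower extremal map
`x ↦ α·x/(1 + x) − ε` has a positive fixed point iff `α ≥ 1 + ε + 2√ε`.
This characterises the bifurcation threshold `α* = 1 + ε + 2√ε`. -/
theorem lower_extremal_fixed_point_iff (ε α : ℝ) (hε : 0 < ε) :
    (∃ x : ℝ, 0 < x ∧ α * x / (1 + x) - ε = x) ↔
      1 + ε + 2 * Real.sqrt ε ≤ α := by
  have hs : 0 < Real.sqrt ε := Real.sqrt_pos.mpr hε
  have hs2 : Real.sqrt ε ^ 2 = ε := Real.sq_sqrt hε.le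
  have fixed_iff : ∀ x : ℝ, 0 < x →
      (α * x / (1 + x) - ε = x ↔ (α - 1 - ε) * x = x ^ 2 + ε) := by
    intro x hx
    rw [sub_eq_iff_eq_add, div_eq_iff (by positivity)]
    constructor <;> intro h <;> linarith
  constructor
  · rintro ⟨x, hx, h⟩
    rw [fixed_iff x hx] at h
    have hle : 2 * Real.sqrt ε * x ≤ (α - 1 - ε) * x := by
      nlinarith [sq_nonneg (x - Real.sqrt ε)]
    linarith [le_of_mul_le_mul_right hle hx]
  · intro h
    have hdisc : 0 ≤ (α - 1 - ε) ^ 2 - 4 * ε := by nlinarith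
    have hroot := Real.sq_sqrt hdisc
    have hroot_nonneg := Real.sqrt_nonneg ((α - 1 - ε) ^ 2 - 4 * ε)
    have hx : 0 < (α - 1 - ε + Real.sqrt ((α - 1 - ε) ^ 2 - 4 * ε)) / 2 := by linarith
    refine ⟨_, hx, (fixed_iff _ hx).mpr ?_⟩
    linear_combination -hroot / 4
end

section
/- Let ε > 0, α > 1 and β ∈ ℝ. Then there exists x > 0 with α·x/(1 + x) + β − ε = x if and only if β ≥ ε − (α + 1 − 2√α). (This characterises the bifurcation threshold β* = −(α + 1 − 2√α) + ε at which a new minimal invariant set appears instantaneously for the ε-perturbed family x ↦ closed ε-ball around f_{α,β}(x).) -/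
/-- For `ε > 0`, `α > 1` and `β ∈ ℝ`, the lower extremal map
`x ↦ α·x/(1 + x) + β − ε` has a positive fixed point iff
`β ≥ ε − (α + 1 − 2√α)`. This characterises the bifurcation threshold
`β* = −(α + 1 − 2√α) + ε` at which a new minimal invariant set appears. -/
theorem lower_extremal_fixed_point_iff_beta (ε α β : ℝ) (hε : 0 < ε) (hα : 1 < α) :
    (∃ x : ℝ, 0 < x ∧ α * x / (1 + x) + β - ε = x) ↔
      ε - (α + 1 - 2 * Real.sqrt α) ≤ β := by
  have hs : √α ^ 2 = α := Real.sq_sqrt (by linarith)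
  have hs1 : 1 < √α := Real.lt_sqrt_of_sq_lt (by linarith)
  have fixed_iff : ∀ x : ℝ, 0 < x → (α * x / (1 + x) + β - ε = x ↔
      (1 + x) ^ 2 + α = (α + 1 + β - ε) * (1 + x)) := by
    intro x hx
    have hx1 : 1 + x ≠ 0 := by positivity
    field_simp
    constructor <;> intro h <;> linarith
  constructor
  · rintro ⟨x, hx, h⟩
    rw [fixed_iff x hx] at h
    have hle : 2 * √α * (1 + x) ≤ (α + 1 + β - ε) * (1 + x) := by
      nlinarith [sq_nonneg (1 + x - √α)]
    linarith [le_of_mul_le_mul_right hle (by positivity)]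
  · intro h
    set c := α + 1 + β - ε with hc
    have hcs : 2 * √α ≤ c := by linarith
    have hdisc : √(c ^ 2 - 4 * α) ^ 2 = c ^ 2 - 4 * α :=
      Real.sq_sqrt (by nlinarith)
    have hx : 0 < (c + √(c ^ 2 - 4 * α)) / 2 - 1 := by
      linarith [Real.sqrt_nonneg (c ^ 2 - 4 * α)]
    refine ⟨_, hx, (fixed_iff _ hx).2 ?_⟩
    linear_combination hdisc / 4
end
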